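/- For every n ≥ 0 and every q' with 0 ≤ q' ≤ 2^{n+1}, the expected minus-operation count satisfies the recursion E_M(n+1, q') = Σ_{q_L = max(0, q'−2^n)}^{min(q', 2^n)} [C(2^n, q_L)·C(2^n, q'−q_L) / C(2^{n+1}, q')] · ( E_M(n, q_L) + E_M(n, q'−q_L) + 2^n·(1 − δ(q_L)) ), where δ(0) = 1 and δ(x) = 0 for x ≠ 0. (Paper's Lemma 2, minus-operations part; the formula with 1 − δ(q_L) is valid because the summand weights are symmetric under exchanging q_L and q'−q_L.) -/

import Mathlib

/-- The left half (first `2^n` coordinates) of a support pattern of length `2^(n+1)`. -/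
def leftHalf (n : ℕ) (z : Fin (2 ^ (n + 1)) → Bool) : Fin (2 ^ n) → Bool :=
  fun i => z ⟨i.val, by have h := i.isLt; have h2 : 2 ^ (n + 1) = 2 ^ n + 2 ^ n := (by ring); omega⟩

/-- The right half (last `2^n` coordinates) of a support pattern of length `2^(n+1)`. -/
def rightHalf (n : ℕ) (z : Fin (2 ^ (n + 1)) → Bool) : Fin (2 ^ n) → Bool :=
  fun i => z ⟨i.val + 2 ^ n, by have h := i.isLt; have h2 : 2 ^ (n + 1) = 2 ^ n + 2 ^ n := (by ring); omega⟩

/-- Hamming weight of a support pattern: the number of nonzero (true) coordinates. -/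
def wt (n : ℕ) (z : Fin (2 ^ n) → Bool) : ℕ :=
  (Finset.univ.filter fun i => z i = true).card

/-- The number of additions performed by the fast Walsh–Hadamard transform on an
input whose support pattern is `z`:  `A(z) = 0` for length 1, and
`A(z) = A(z_L) + A(z_R) + 2^(n+1)·[z_L ≠ 0 ∧ z_R ≠ 0]` for length `2^(n+1)`. -/
def addCount : (n : ℕ) → (Fin (2 ^ n) → Bool) → ℕ
  | 0, _ => 0
  | n + 1, z =>
      addCount n (leftHalf n z) + addCount n (rightHalf n z) +
        (if (∃ i, leftHalf n z i = true) ∧ (∃ i, rightHalf n z i = true)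
          then 2 ^ (n + 1) else 0)

/-- The number of minus operations performed by the fast Walsh–Hadamard transform
on an input whose support pattern is `z`:  `M(z) = 0` for length 1, and
`M(z) = M(z_L) + M(z_R) + 2^n·[z_R ≠ 0]` for length `2^(n+1)`. -/
def minusCount : (n : ℕ) → (Fin (2 ^ n) → Bool) → ℕ
  | 0, _ => 0
  | n + 1, z =>
      minusCount n (leftHalf n z) + minusCount n (rightHalf n z) +
        (if ∃ i, rightHalf n z i = true then 2 ^ n else 0)

/-- Expected number of additions of the fast WH transform of length `2^n`,
under the uniform distribution on support patterns of Hamming weight `q'`. -/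
noncomputable def EA (n q' : ℕ) : ℝ :=
  (∑ z ∈ Finset.univ.filter fun z : Fin (2 ^ n) → Bool => wt n z = q',
    (addCount n z : ℝ)) / (Nat.choose (2 ^ n) q' : ℝ)

/-- Expected number of minus operations of the fast WH transform of length `2^n`,
under the uniform distribution on support patterns of Hamming weight `q'`. -/
noncomputable def EM (n q' : ℕ) : ℝ :=
  (∑ z ∈ Finset.univ.filter fun z : Fin (2 ^ n) → Bool => wt n z = q',
    (minusCount n z : ℝ)) / (Nat.choose (2 ^ n) q' : ℝ)

/-- Splitting a support pattern into its two halves is a bijection. -/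
def halvesEquiv (n : ℕ) :
    (Fin (2 ^ (n + 1)) → Bool) ≃ (Fin (2 ^ n) → Bool) × (Fin (2 ^ n) → Bool) :=
  (Equiv.arrowCongr (finCongr (show 2 ^ (n + 1) = 2 ^ n + 2 ^ n by ring)) (Equiv.refl Bool)).trans
    (Fin.appendEquiv (2 ^ n) (2 ^ n)).symm

theorem halvesEquiv_apply (n : ℕ) (z : Fin (2 ^ (n + 1)) → Bool) :
    halvesEquiv n z = (leftHalf n z, rightHalf n z) := by
  refine Prod.ext (funext fun i => ?_) (funext fun i => congrArg z (Fin.ext ?_))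
  · rfl
  · exact Nat.add_comm _ _

theorem wt_succ (n : ℕ) (z : Fin (2 ^ (n + 1)) → Bool) :
    wt (n + 1) z = wt n (leftHalf n z) + wt n (rightHalf n z) := by
  simp only [wt, Finset.card_filter]
  rw [← (finCongr (show 2 ^ n + 2 ^ n = 2 ^ (n + 1) by ring)).sum_comp, Fin.sum_univ_add]
  refine congrArg₂ _ rfl (Finset.sum_congr rfl fun i _ => ?_)
  have h : finCongr (show 2 ^ n + 2 ^ n = 2 ^ (n + 1) by ring) (Fin.natAdd (2 ^ n) i) =
      ⟨i.val + 2 ^ n, by have h := i.isLt; rw [pow_succ]; omega⟩ :=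
    Fin.ext (Nat.add_comm _ _)
  rw [h]
  rfl

theorem card_filter_wt (n q : ℕ) :
    (Finset.univ.filter fun z : Fin (2 ^ n) → Bool => wt n z = q).card =
      Nat.choose (2 ^ n) q := by
  have h : Nat.choose (2 ^ n) q =
      (Finset.powersetCard q (Finset.univ : Finset (Fin (2 ^ n)))).card := by simp
  rw [h]
  refine Finset.card_nbij' (fun z => Finset.univ.filter fun i => z i = true)
    (fun s i => decide (i ∈ s)) ?_ ?_ ?_ ?_
  · intro z hz
    have hz' := (Finset.mem_filter.mp (Finset.mem_coe.mp hz)).2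
    simpa [wt] using hz'
  · intro s hs
    refine Finset.mem_coe.mpr (Finset.mem_filter.mpr ⟨Finset.mem_univ _, ?_⟩)
    simpa [wt] using hs
  · intro z _
    ext i
    simp
  · intro s _
    ext i
    simp

theorem exists_eq_true_iff_wt_ne_zero (n : ℕ) (z : Fin (2 ^ n) → Bool) :
    (∃ i, z i = true) ↔ wt n z ≠ 0 := by
  simp [wt, Finset.filter_eq_empty_iff]

theorem sum_minusCount (n q : ℕ) :
    ∑ z ∈ Finset.univ.filter (fun z : Fin (2 ^ n) → Bool => wt n z = q), (minusCount n z : ℝ) =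
      Nat.choose (2 ^ n) q * EM n q := by
  by_cases h : Nat.choose (2 ^ n) q = 0
  · have := card_filter_wt n q
    rw [h, Finset.card_eq_zero] at this
    simp [this, h]
  · rw [EM, mul_div_cancel₀]
    exact_mod_cast h

/-- A sum over patterns of weight `q` splits according to the weights of the two halves. -/
theorem sum_filter_wt_succ (n q : ℕ)
    (f : (Fin (2 ^ n) → Bool) → (Fin (2 ^ n) → Bool) → ℝ) :
    ∑ z ∈ Finset.univ.filter (fun z : Fin (2 ^ (n + 1)) → Bool => wt (n + 1) z = q),
        f (leftHalf n z) (rightHalf n z) =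
      ∑ p ∈ Finset.HasAntidiagonal.antidiagonal q,
        ∑ x ∈ Finset.univ.filter (fun x : Fin (2 ^ n) → Bool => wt n x = p.1),
          ∑ y ∈ Finset.univ.filter (fun y : Fin (2 ^ n) → Bool => wt n y = p.2), f x y := by
  have hL : ∑ z ∈ Finset.univ.filter (fun z : Fin (2 ^ (n + 1)) → Bool => wt (n + 1) z = q),
      f (leftHalf n z) (rightHalf n z) =
      ∑ xy ∈ Finset.univ.filter (fun xy : (Fin (2 ^ n) → Bool) × (Fin (2 ^ n) → Bool) =>
        wt n xy.1 + wt n xy.2 = q), f xy.1 xy.2 := by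
    refine Finset.sum_equiv (halvesEquiv n) (fun z => ?_) (fun z _ => ?_)
    · simp [halvesEquiv_apply, wt_succ]
    · simp [halvesEquiv_apply]
  rw [hL, ← Finset.sum_fiberwise_of_maps_to (t := Finset.HasAntidiagonal.antidiagonal q)
    (g := fun xy => (wt n xy.1, wt n xy.2)) (fun xy h => by simpa using h)]
  refine Finset.sum_congr rfl fun p hp => ?_
  rw [← Finset.sum_product']
  refine Finset.sum_congr (Finset.ext fun xy => ?_) fun _ _ => rfl
  rw [Finset.HasAntidiagonal.mem_antidiagonal] at hp
  simp only [Finset.mem_filter, Finset.mem_univ, true_and, Finset.mem_product, Prod.ext_iff]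
  omega

theorem sum_minusCount_succ (n q : ℕ) :
    ∑ z ∈ Finset.univ.filter (fun z : Fin (2 ^ (n + 1)) → Bool => wt (n + 1) z = q),
        (minusCount (n + 1) z : ℝ) =
      ∑ p ∈ Finset.HasAntidiagonal.antidiagonal q,
        (Nat.choose (2 ^ n) p.1 : ℝ) * (Nat.choose (2 ^ n) p.2 : ℝ) *
          (EM n p.1 + EM n p.2 + (2 : ℝ) ^ n * (1 - if p.2 = 0 then 1 else 0)) := by
  have h := sum_filter_wt_succ n q fun x y =>
    (minusCount n x : ℝ) + minusCount n y + (2 : ℝ) ^ n * (1 - if wt n y = 0 then 1 else 0)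
  have hM : ∀ z, (minusCount (n + 1) z : ℝ) =
      (minusCount n (leftHalf n z) : ℝ) + minusCount n (rightHalf n z) +
        (2 : ℝ) ^ n * (1 - if wt n (rightHalf n z) = 0 then 1 else 0) := by
    intro z
    simp only [minusCount, exists_eq_true_iff_wt_ne_zero]
    split_ifs <;> simp_all
  rw [Finset.sum_congr rfl fun z _ => hM z, h]
  refine Finset.sum_congr rfl fun p _ => ?_
  have hy : ∀ x : Fin (2 ^ n) → Bool,
      ∑ y ∈ Finset.univ.filter (fun y : Fin (2 ^ n) → Bool => wt n y = p.2),
        ((minusCount n x : ℝ) + minusCount n y +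
          (2 : ℝ) ^ n * (1 - if wt n y = 0 then 1 else 0)) =
      Nat.choose (2 ^ n) p.2 * (minusCount n x : ℝ) + Nat.choose (2 ^ n) p.2 *
        (EM n p.2 + (2 : ℝ) ^ n * (1 - if p.2 = 0 then 1 else 0)) := by
    intro x
    rw [Finset.sum_congr rfl fun y hy => by rw [(Finset.mem_filter.mp hy).2]]
    simp only [Finset.sum_add_distrib, Finset.sum_const, card_filter_wt, sum_minusCount,
      nsmul_eq_mul]
    ring
  simp only [hy, Finset.sum_add_distrib, ← Finset.mul_sum, Finset.sum_const, card_filter_wt,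
    sum_minusCount, nsmul_eq_mul]
  ring

/-- **Paper's Lemma 2 (minus-operations part).**  For every `n ≥ 0` and
`0 ≤ q' ≤ 2^(n+1)`,
`E_M(n+1, q') = Σ_{q_L = max(0, q'-2^n)}^{min(q', 2^n)}
  [C(2^n,q_L)·C(2^n,q'-q_L)/C(2^(n+1),q')] ·
  (E_M(n,q_L) + E_M(n,q'-q_L) + 2^n·(1 - δ(q_L)))`,
where `δ(0) = 1` and `δ(x) = 0` for `x ≠ 0`. -/
theorem EM_recursion (n q' : ℕ) (hq : q' ≤ 2 ^ (n + 1)) :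
    EM (n + 1) q' =
      ∑ qL ∈ Finset.Icc (max 0 (q' - 2 ^ n)) (min q' (2 ^ n)),
        ((Nat.choose (2 ^ n) qL : ℝ) * (Nat.choose (2 ^ n) (q' - qL) : ℝ) /
            (Nat.choose (2 ^ (n + 1)) q' : ℝ)) *
          (EM n qL + EM n (q' - qL) +
            (2 : ℝ) ^ n * (1 - if qL = 0 then 1 else 0)) := by
  have hsub : Finset.Icc (max 0 (q' - 2 ^ n)) (min q' (2 ^ n)) ⊆ Finset.range q'.succ := by
    intro a ha
    simp only [Finset.mem_Icc, Finset.mem_range] at ha ⊢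
    omega
  rw [EM, sum_minusCount_succ, ← Finset.Nat.sum_antidiagonal_swap,
    Finset.Nat.sum_antidiagonal_eq_sum_range_succ_mk, Finset.sum_div]
  symm
  refine (Finset.sum_subset hsub fun a ha ha' => ?_).trans
    (Finset.sum_congr rfl fun a _ => ?_)
  · simp only [Finset.mem_Icc, Finset.mem_range] at ha ha'
    obtain h | h : 2 ^ n < a ∨ 2 ^ n < q' - a := by omega
    · simp [Nat.choose_eq_zero_of_lt h]
    · simp [Nat.choose_eq_zero_of_lt h]
  · simp only [Prod.swap_prod_mk]
    ring
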